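/- arXiv:1810.05097 — 3 statements merged into one kernel-verified Lean document; each statement's English description precedes it below -/
import Mathlib

section
/- Let (X,d) be a compact metric space and let T₁, T₂, …, T_k be pairwise commuting self-homeomorphisms of X. Then for every ε > 0 there exist x ∈ X and n ∈ ℕ with n ≥ 1 such that d(T_i^n x, x) < ε for all i = 1, 2, …, k. -/
/-- Let `(X, dist)` be a (nonempty) compact metric space and `T₁, …, T_k` pairwise
commuting self-homeomorphisms of `X`.  Then for every `ε > 0` there exist `x ∈ X`
and `n ≥ 1` such that `dist (T_i^n x) x < ε` for all `i`. -/
theorem multiple_recurrence_commuting_homeos {X : Type*} [MetricSpace X] [CompactSpace X]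
    [Nonempty X] (k : ℕ) (T : Fin k → X ≃ₜ X)
    (hcomm : ∀ i j : Fin k, ∀ x : X, T i (T j x) = T j (T i x))
    (ε : ℝ) (hε : 0 < ε) :
    ∃ (x : X) (n : ℕ), 1 ≤ n ∧ ∀ i : Fin k, dist ((T i : X → X)^[n] x) x < ε := by
  open scoped IsMulCommutative in
  classical
  obtain ⟨t, -, ht_fin, ht⟩ := finite_cover_balls_of_compact (isCompact_univ (X := X)) (half_pos hε)
  have hcover (y : X) : ∃ c : t, dist y c < ε / 2 := by
    simpa using ht (Set.mem_univ y)
  choose color hcolor using hcover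
  have := ht_fin.to_subtype
  let range := Set.range fun i ↦ ((T i).toEquiv : Equiv.Perm X)
  have : IsMulCommutative (Submonoid.closure range) := Submonoid.isMulCommutative_closure _ (by
    rintro _ ⟨i, rfl⟩ _ ⟨j, rfl⟩
    exact Equiv.ext fun x ↦ hcomm i j x)
  let gen (i : Fin k) : Submonoid.closure range :=
    ⟨(T i).toEquiv, Submonoid.subset_closure ⟨i, rfl⟩⟩
  let x₀ : X := Classical.arbitrary X
  obtain ⟨n, hn, b, c, hc⟩ := Combinatorics.exists_mono_homothetic_copy
    (M := Additive (Submonoid.closure range))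
    (insert 0 (Finset.univ.image fun i ↦ Additive.ofMul (gen i)))
    fun g ↦ color (g.toMul.1 x₀)
  refine ⟨b.toMul.1 x₀, n, hn, fun i ↦ ?_⟩
  have h_base : color (b.toMul.1 x₀) = c := by
    simpa using hc 0 (Finset.mem_insert_self _ _)
  have h_iterate : color ((T i : X → X)^[n] (b.toMul.1 x₀)) = c := by
    rw [← hc (Additive.ofMul (gen i)) (by simp)]
    congr 1
  have h₁ := hcolor ((T i : X → X)^[n] (b.toMul.1 x₀))
  have h₂ := hcolor (b.toMul.1 x₀)
  rw [h_iterate] at h₁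
  rw [h_base] at h₂
  linarith [dist_triangle_right ((T i : X → X)^[n] (b.toMul.1 x₀)) (b.toMul.1 x₀) (c : X)]
end

section
/- Let (X,d) be a compact metric space, and for i = 1,…,k let α ↦ T_α^{(i)} be IP-systems of self-homeomorphisms of X such that all the homeomorphisms {T_α^{(i)} : 1 ≤ i ≤ k, α ∈ 𝓕} pairwise commute. Then for every ε > 0 there exist x ∈ X and a nonempty α ∈ 𝓕 such that d(T_α^{(i)} x, x) < ε for all i = 1, 2, …, k. -/
open Combinatorics in
/-- A monoid form of the Hales–Jewett theorem: for finitely many sequences in a commutative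
monoid and a finite colouring, some element keeps its colour when multiplied by the product
of each of the sequences over a common nonempty finite index set. -/
theorem exists_color_prod_mul_eq {M κ I : Type*} [CommMonoid M] [Finite κ] [Finite I]
    (t : I → ℕ → M) (C : M → κ) :
    ∃ (m : M) (α : Finset ℕ), α.Nonempty ∧ ∀ i, C ((∏ j ∈ α, t i j) * m) = C m := by
  classical
  obtain ⟨ι, _, h⟩ := Line.exists_mono_in_high_dimension (Option I) κ
  let e : ι → ℕ := fun j => Fintype.equivFin ι j
  have he : Function.Injective e := Fin.val_injective.comp (Fintype.equivFin ι).injective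
  let P : (ι → Option I) → M := fun w => ∏ j, (w j).elim 1 fun i => t i (e j)
  obtain ⟨l, c, hl⟩ := h fun w => C (P w)
  obtain ⟨j₀, hj₀⟩ := l.proper
  refine ⟨P (l none), (Finset.univ.filter fun j => l.idxFun j = none).image e,
    ⟨e j₀, Finset.mem_image_of_mem e (by simp [hj₀])⟩, fun i => ?_⟩
  have key : (∏ j ∈ (Finset.univ.filter fun j => l.idxFun j = none).image e, t i j) * P (l none)
      = P (l (some i)) := by
    rw [Finset.prod_image he.injOn, Finset.prod_filter, ← Finset.prod_mul_distrib]
    refine Finset.prod_congr rfl fun j _ => ?_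
    cases hj : l.idxFun j <;> simp [hj, Line.coe_apply]
  rw [key]
  exact (hl (some i)).trans (hl none).symm

/-- An IP-system with values in a commutative monoid is determined by its values on singletons. -/
theorem ip_system_eq_prod_singleton {M : Type*} [CommMonoid M] (g : Finset ℕ → M)
    (hg : ∀ α β : Finset ℕ, α.Nonempty → β.Nonempty → Disjoint α β → g (α ∪ β) = g α * g β)
    {α : Finset ℕ} (hα : α.Nonempty) : g α = ∏ j ∈ α, g {j} := by
  induction hα using Finset.Nonempty.cons_induction with
  | singleton a => simp
  | cons a s ha hs ih =>
    rw [Finset.prod_cons, ← ih, Finset.cons_eq_insert, Finset.insert_eq]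
    exact hg _ _ (Finset.singleton_nonempty a) hs (Finset.disjoint_singleton_left.2 ha)

/-- IP multiple recurrence (Furstenberg–Weiss): let `(X, dist)` be a (nonempty) compact
metric space and, for `i = 1, …, k`, let `α ↦ T i α` be IP-systems of self-homeomorphisms
of `X` (indexed by the nonempty finite subsets `α` of `ℕ`, with
`T i (α ∪ β) = T i α ∘ T i β` when `α, β` are disjoint) such that all the homeomorphisms
involved pairwise commute.  Then for every `ε > 0` there exist `x ∈ X` and a nonempty
`α` such that `dist (T i α x) x < ε` for all `i`. -/
theorem ip_multiple_recurrence_commuting_homeos {X : Type*} [MetricSpace X] [CompactSpace X]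
    [Nonempty X] (k : ℕ) (T : Fin k → Finset ℕ → X ≃ₜ X)
    (hIP : ∀ i : Fin k, ∀ α β : Finset ℕ, α.Nonempty → β.Nonempty → Disjoint α β →
      ∀ x : X, T i (α ∪ β) x = T i α (T i β x))
    (hcomm : ∀ i j : Fin k, ∀ α β : Finset ℕ, α.Nonempty → β.Nonempty →
      ∀ x : X, T i α (T j β x) = T j β (T i α x))
    (ε : ℝ) (hε : 0 < ε) :
    ∃ (x : X) (α : Finset ℕ), α.Nonempty ∧ ∀ i : Fin k, dist (T i α x) x < ε := by
  let S : Set (X ≃ₜ X) := {f | ∃ (i : Fin k) (α : Finset ℕ), α.Nonempty ∧ T i α = f}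
  have hS : ∀ f ∈ S, ∀ g ∈ S, f * g = g * f := by
    rintro _ ⟨i, α, hα, rfl⟩ _ ⟨j, β, hβ, rfl⟩
    exact Homeomorph.ext (hcomm i j α β hα hβ)
  have hcl : IsMulCommutative (Subgroup.closure S) := Subgroup.isMulCommutative_closure hS
  let : CommGroup (Subgroup.closure S) :=
    { (inferInstance : Group (Subgroup.closure S)) with mul_comm := hcl.is_comm.comm }
  let g : Fin k → Finset ℕ → Subgroup.closure S := fun i α =>
    if h : α.Nonempty then ⟨T i α, Subgroup.subset_closure ⟨i, α, h, rfl⟩⟩ else 1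
  have hgT : ∀ i {α : Finset ℕ}, α.Nonempty → (g i α : X ≃ₜ X) = T i α := fun i α h => by
    simp [g, h]
  have hg : ∀ i (α β : Finset ℕ), α.Nonempty → β.Nonempty → Disjoint α β →
      g i (α ∪ β) = g i α * g i β := by
    intro i α β hα hβ h
    apply Subtype.ext
    change (g i (α ∪ β) : X ≃ₜ X) = (g i α : X ≃ₜ X) * (g i β : X ≃ₜ X)
    rw [hgT i hα, hgT i hβ, hgT i (hα.mono Finset.subset_union_left)]
    exact Homeomorph.ext (hIP i α β hα hβ h)
  obtain ⟨s, -, hs, hcov⟩ := Metric.finite_approx_of_totallyBounded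
    (isCompact_univ (X := X)).totallyBounded (ε / 2) (half_pos hε)
  have hball : ∀ x : X, ∃ y : s, dist x y < ε / 2 := fun x => by
    simpa using hcov (Set.mem_univ x)
  choose C hC using hball
  have : Finite s := hs
  obtain ⟨x₀⟩ := ‹Nonempty X›
  obtain ⟨m, α, hα, h⟩ := exists_color_prod_mul_eq (fun i j => g i {j})
    fun f => C ((f : X ≃ₜ X) x₀)
  refine ⟨(m : X ≃ₜ X) x₀, α, hα, fun i => ?_⟩
  have hi := h i
  rw [← ip_system_eq_prod_singleton (g i) (hg i) hα] at hi
  change C ((g i α : X ≃ₜ X) ((m : X ≃ₜ X) x₀)) = C ((m : X ≃ₜ X) x₀) at hi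
  rw [hgT i hα] at hi
  have h₁ := hC (T i α ((m : X ≃ₜ X) x₀))
  rw [hi] at h₁
  linarith [dist_triangle_right (T i α ((m : X ≃ₜ X) x₀)) ((m : X ≃ₜ X) x₀)
    (C ((m : X ≃ₜ X) x₀)), hC ((m : X ≃ₜ X) x₀)]
end

section
/- Let G be a (discrete) group, let A be a piecewise syndetic subset of G, and let q be an ultrafilter on G belonging to some minimal left ideal of βG with A ∈ q. Then the set B = {γ ∈ G : γ⁻¹A ∈ q} is syndetic in G; that is, there exists a finite set H ⊆ G with G = ⋃_{t∈H} t⁻¹B. -/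
attribute [local instance] Ultrafilter.mul

/-- A *left ideal* of `βG = Ultrafilter G`: a nonempty set closed under left
multiplication by arbitrary ultrafilters. -/
def IsLeftIdeal {G : Type*} [Group G] (L : Set (Ultrafilter G)) : Prop :=
  L.Nonempty ∧ ∀ p q : Ultrafilter G, q ∈ L → p * q ∈ L

/-- A *minimal left ideal* of `βG`: a left ideal containing no proper left ideal. -/
def IsMinimalLeftIdeal {G : Type*} [Group G] (L : Set (Ultrafilter G)) : Prop :=
  IsLeftIdeal L ∧ ∀ L' : Set (Ultrafilter G), IsLeftIdeal L' → L' ⊆ L → L' = L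

/-- `A ⊆ G` is *piecewise syndetic* if there is a finite `H ⊆ G` such that for every
finite `F ⊆ G` there exists `x ∈ G` with `F·x ⊆ ⋃_{t ∈ H} t⁻¹A`. -/
def PiecewiseSyndetic {G : Type*} [Group G] (A : Set G) : Prop :=
  ∃ H : Finset G, ∀ F : Finset G, ∃ x : G, ∀ f ∈ F, ∃ t ∈ H, t * (f * x) ∈ A

/-- If no finite set of left translates of `B` covers `G`, then some ultrafilter contains none of
these translates. -/
theorem exists_ultrafilter_forall_translate_notMem {G : Type*} [Group G] {B : Set G}
    (hB : ∀ H : Finset G, ∃ g : G, ∀ t ∈ H, t * g ∉ B) :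
    ∃ p : Ultrafilter G, ∀ t : G, {g : G | t * g ∈ B} ∉ p := by
  classical
  obtain ⟨p, hp⟩ := Ultrafilter.exists_ultrafilter_of_finite_inter_nonempty
    (Set.range fun t : G => {g : G | t * g ∈ B}ᶜ) (by
      intro T hT
      rw [← Set.image_univ] at hT
      obtain ⟨H, -, rfl⟩ := Finset.subset_set_image_iff.mp hT
      obtain ⟨g, hg⟩ := hB H
      refine ⟨g, ?_⟩
      simpa using hg)
  exact ⟨p, fun t => Ultrafilter.compl_mem_iff_notMem.mp (hp ⟨t, rfl⟩)⟩

/-- An element of a minimal left ideal is recovered from each of its left multiples by a further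
left multiplication. -/
theorem IsMinimalLeftIdeal.exists_mul_mul_eq {G : Type*} [Group G] {L : Set (Ultrafilter G)}
    (hL : IsMinimalLeftIdeal L) {q : Ultrafilter G} (hq : q ∈ L) (p : Ultrafilter G) :
    ∃ r : Ultrafilter G, r * (p * q) = q := by
  have hideal : IsLeftIdeal (Set.range fun r : Ultrafilter G => r * (p * q)) := by
    refine ⟨⟨_, p, rfl⟩, ?_⟩
    rintro s _ ⟨r, rfl⟩
    exact ⟨s * r, Ultrafilter.semigroup.mul_assoc s r (p * q)⟩
  have hsub : (Set.range fun r : Ultrafilter G => r * (p * q)) ⊆ L := by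
    rintro _ ⟨r, rfl⟩
    exact hL.1.2 r _ (hL.1.2 p q hq)
  rwa [← hL.2 _ hideal hsub] at hq

/-- Let `G` be a group, `A ⊆ G` piecewise syndetic, and `q` an ultrafilter on `G` lying in
some minimal left ideal of `βG` with `A ∈ q`.  Then `B = {γ ∈ G : γ⁻¹A ∈ q}` is syndetic:
there is a finite `H ⊆ G` with `G = ⋃_{t ∈ H} t⁻¹B`. -/
theorem syndetic_of_piecewiseSyndetic_minimal {G : Type*} [Group G]
    (A : Set G) (hA : PiecewiseSyndetic A)
    (q : Ultrafilter G) (hq : ∃ L : Set (Ultrafilter G), IsMinimalLeftIdeal L ∧ q ∈ L)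
    (hAq : A ∈ q) :
    ∃ H : Finset G, ∀ g : G, ∃ t ∈ H, {y : G | (t * g) * y ∈ A} ∈ q := by
  by_contra! hB
  obtain ⟨p, hp⟩ := exists_ultrafilter_forall_translate_notMem
    (B := {g : G | {y : G | g * y ∈ A} ∈ q}) hB
  obtain ⟨L, hL, hqL⟩ := hq
  obtain ⟨r, hr⟩ := hL.exists_mul_mul_eq hqL p
  rw [← hr] at hAq
  have hmem : {x : G | {g : G | {y : G | x * (g * y) ∈ A} ∈ q} ∈ p} ∈ r := hAq
  obtain ⟨x, hx⟩ := Ultrafilter.nonempty_of_mem hmem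
  refine hp x ?_
  simpa only [Set.mem_ofPred_eq, mul_assoc] using hx
end
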